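/- For every constant c ≥ 1 there is a constant C = C(c) > 0 such that the following holds. Let 1 ≤ p < 2, let m ≥ 2, d ≥ 2, let w ∈ ℝ^m with w_i ≥ 1 for all i, let A' ∈ ℝ^{m×d} satisfy A'^T·diag(w)·A' = I_d, and let τ ≥ max_{i∈[m]} w_i·‖a_i'‖_2^2, where a_i' are the rows of A'. Then for every t ≥ d^{−c} there exists a finite set N ⊆ ℝ^d with log|N| ≤ C·(1/t^p)·( (log d)/(2−p) + log m )·τ such that for every x ∈ ℝ^d with ‖A'x‖_{w,p} ≤ 1 there exists x' ∈ N with max_{i∈[m]} |a_i'(x − x')| ≤ t. -/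

import Mathlib

open Matrix

/-- The weighted `ℓ_p` norm `‖v‖_{w,p} = (∑_i w_i |v_i|^p)^{1/p}`. -/
noncomputable def wNorm {m : ℕ} (w : Fin m → ℝ) (p : ℝ) (v : Fin m → ℝ) : ℝ :=
  (∑ i, w i * |v i| ^ p) ^ (1 / p)

section Covering

open scoped Pointwise

variable {m d : ℕ}

/-- The symmetrised dictionary `{0} ∪ {± b_i}` formed by the rows `b_i` of a matrix. -/
noncomputable def signedRows (B : Matrix (Fin m) (Fin d) ℝ) : Finset (Fin d → ℝ) :=
  insert 0 (Finset.univ.image (fun i => B i) ∪ Finset.univ.image (fun i => -B i))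

lemma zero_mem_signedRows (B : Matrix (Fin m) (Fin d) ℝ) : 0 ∈ signedRows B := by
  simp [signedRows]

lemma row_mem_signedRows (B : Matrix (Fin m) (Fin d) ℝ) (i : Fin m) : B i ∈ signedRows B :=
  Finset.mem_insert_of_mem (Finset.mem_union_left _ (Finset.mem_image_of_mem _ (Finset.mem_univ i)))

lemma neg_row_mem_signedRows (B : Matrix (Fin m) (Fin d) ℝ) (i : Fin m) :
    -B i ∈ signedRows B :=
  Finset.mem_insert_of_mem
    (Finset.mem_union_right _ (Finset.mem_image_of_mem (fun i => -B i) (Finset.mem_univ i)))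

lemma card_signedRows_le (B : Matrix (Fin m) (Fin d) ℝ) : (signedRows B).card ≤ 2 * m + 1 := by
  refine (Finset.card_insert_le _ _).trans (Nat.add_le_add_right ?_ 1)
  refine (Finset.card_union_le _ _).trans ?_
  have h₁ := Finset.card_image_le (s := (Finset.univ : Finset (Fin m))) (f := fun i => B i)
  have h₂ := Finset.card_image_le (s := (Finset.univ : Finset (Fin m))) (f := fun i => -B i)
  simp only [Finset.card_univ, Fintype.card_fin] at h₁ h₂
  omega

lemma zero_mem_nsmul_signedRows (B : Matrix (Fin m) (Fin d) ℝ) (n : ℕ) :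
    0 ∈ n • signedRows B := by
  induction n with
  | zero => simp
  | succ n ih =>
    rw [succ_nsmul]
    exact Finset.mem_add.2 ⟨0, ih, 0, zero_mem_signedRows B, by simp⟩

lemma dotProduct_self_le_of_mem_signedRows {B : Matrix (Fin m) (Fin d) ℝ} {τ : ℝ} (hτ : 0 ≤ τ)
    (hB : ∀ i, B i ⬝ᵥ B i ≤ τ) {g : Fin d → ℝ} (hg : g ∈ signedRows B) : g ⬝ᵥ g ≤ τ := by
  simp only [signedRows, Finset.mem_insert, Finset.mem_union, Finset.mem_image, Finset.mem_univ,
    true_and] at hg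
  rcases hg with rfl | ⟨i, rfl⟩ | ⟨i, rfl⟩
  · simpa using hτ
  · exact hB i
  · simpa using hB i

lemma two_mul_abs_dotProduct_le (u v : Fin d → ℝ) : 2 * |u ⬝ᵥ v| ≤ u ⬝ᵥ u + v ⬝ᵥ v := by
  have h₁ : 0 ≤ (u - v) ⬝ᵥ (u - v) := Finset.sum_nonneg fun i _ => mul_self_nonneg _
  have h₂ : 0 ≤ (u + v) ⬝ᵥ (u + v) := Finset.sum_nonneg fun i _ => mul_self_nonneg _
  simp only [sub_dotProduct, dotProduct_sub, add_dotProduct, dotProduct_add] at h₁ h₂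
  rw [dotProduct_comm v u] at h₁ h₂
  rcases abs_cases (u ⬝ᵥ v) with ⟨h, _⟩ | ⟨h, _⟩ <;> rw [h] <;> linarith

/-- Covering a Euclidean ball in the row-wise sup norm: the perceptron algorithm stops after as
many steps as the radius allows. -/
lemma exists_nsmul_signedRows_abs_mulVec_le {B : Matrix (Fin m) (Fin d) ℝ} {τ t : ℝ} (hτ : 0 < τ)
    (hB : ∀ i, B i ⬝ᵥ B i ≤ τ) (ht : 0 < t) (n : ℕ) :
    ∀ e : Fin d → ℝ, e ⬝ᵥ e ≤ n * (t ^ 2 / τ) →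
      ∃ g ∈ n • signedRows B, ∀ i, |(B *ᵥ (e - (t / τ) • g)) i| ≤ t := by
  induction n with
  | zero =>
    intro e he
    have h0 : e ⬝ᵥ e = 0 := le_antisymm (by simpa using he)
      (Finset.sum_nonneg fun i _ => mul_self_nonneg _)
    obtain rfl := dotProduct_self_eq_zero.1 h0
    exact ⟨0, by simp, fun i => by simpa using ht.le⟩
  | succ n ih =>
    intro e he
    by_cases hall : ∀ i, |(B *ᵥ e) i| ≤ t
    · exact ⟨0, zero_mem_nsmul_signedRows B _, by simpa using hall⟩
    push Not at hall
    obtain ⟨i, hi⟩ := hall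
    have hstep : ∃ g ∈ signedRows B, t < g ⬝ᵥ e := by
      rcases lt_abs.1 hi with h | h
      · exact ⟨B i, row_mem_signedRows B i, h⟩
      · exact ⟨-B i, neg_row_mem_signedRows B i, by rw [neg_dotProduct]; exact h⟩
    obtain ⟨g, hg, hge⟩ := hstep
    have hgg := dotProduct_self_le_of_mem_signedRows hτ.le hB hg
    obtain ⟨g', hg', h'⟩ := ih (e - (t / τ) • g) (by
      simp only [sub_dotProduct, dotProduct_sub, smul_dotProduct, dotProduct_smul, smul_eq_mul]
      rw [dotProduct_comm e g]
      have hη : 0 < t / τ := div_pos ht hτ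
      have h₁ : t / τ * t ≤ t / τ * (g ⬝ᵥ e) := by gcongr
      have h₂ : t / τ * (t / τ * (g ⬝ᵥ g)) ≤ t / τ * (t / τ * τ) := by gcongr
      have h₃ : t / τ * (t / τ * τ) = t ^ 2 / τ := by field_simp
      have h₄ : t / τ * t = t ^ 2 / τ := by ring
      push_cast at he
      linarith)
    refine ⟨g' + g, by rw [succ_nsmul]; exact Finset.add_mem_add hg' hg, fun i => ?_⟩
    have := h' i
    rwa [sub_sub, ← smul_add, add_comm g] at this

lemma abs_sum_smul_dotProduct_le {B : Matrix (Fin m) (Fin d) ℝ} {a : Fin m → ℝ}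
    (ha : ∑ i, |a i| ≤ 1) {u : Fin d → ℝ} {M : ℝ} (hM : 0 ≤ M) (hu : ∀ i, |u ⬝ᵥ B i| ≤ M) :
    |u ⬝ᵥ ∑ i, a i • B i| ≤ M := by
  rw [dotProduct_sum]
  calc |∑ i, u ⬝ᵥ a i • B i| ≤ ∑ i, |u ⬝ᵥ a i • B i| := Finset.abs_sum_le_sum_abs _ _
    _ ≤ ∑ i, |a i| * M := Finset.sum_le_sum fun i _ => by
        rw [dotProduct_smul, smul_eq_mul, abs_mul]
        exact mul_le_mul_of_nonneg_left (hu i) (abs_nonneg _)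
    _ = (∑ i, |a i|) * M := by rw [Finset.sum_mul]
    _ ≤ 1 * M := by gcongr
    _ = M := one_mul M

lemma exists_mem_signedRows_dotProduct_le (B : Matrix (Fin m) (Fin d) ℝ) {a : Fin m → ℝ}
    (ha : ∑ i, |a i| ≤ 1) (u : Fin d → ℝ) :
    ∃ g ∈ signedRows B, u ⬝ᵥ g ≤ u ⬝ᵥ ∑ i, a i • B i := by
  rcases isEmpty_or_nonempty (Fin m) with hm | hm
  · exact ⟨0, zero_mem_signedRows B, by simp⟩
  obtain ⟨k, hk⟩ := Finite.exists_max fun i => |u ⬝ᵥ B i|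
  have h := (abs_le.1 (abs_sum_smul_dotProduct_le ha (abs_nonneg _) hk)).1
  rcases abs_choice (u ⬝ᵥ B k) with hc | hc
  · exact ⟨-B k, neg_row_mem_signedRows B k, by rw [dotProduct_neg]; linarith⟩
  · exact ⟨B k, row_mem_signedRows B k, by linarith⟩

/-- A greedy form of Maurey's empirical method. -/
lemma exists_nsmul_signedRows_approx {B : Matrix (Fin m) (Fin d) ℝ} {τ : ℝ} (hτ : 0 ≤ τ)
    (hB : ∀ i, B i ⬝ᵥ B i ≤ τ) {a : Fin m → ℝ} (ha : ∑ i, |a i| ≤ 1) (k : ℕ) :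
    ∃ g ∈ k • signedRows B,
      (g - (k : ℝ) • ∑ i, a i • B i) ⬝ᵥ (g - (k : ℝ) • ∑ i, a i • B i) ≤ 4 * k * τ := by
  set y := ∑ i, a i • B i with hy
  have hyτ : y ⬝ᵥ y ≤ τ := by
    have hyy : 0 ≤ y ⬝ᵥ y := Finset.sum_nonneg fun i _ => mul_self_nonneg _
    have h := abs_sum_smul_dotProduct_le (B := B) ha (u := y) (M := (τ + y ⬝ᵥ y) / 2) (by positivity)
      fun i => by
        have := two_mul_abs_dotProduct_le y (B i)
        have := hB i
        linarith
    linarith [le_abs_self (y ⬝ᵥ y)]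
  induction k with
  | zero => exact ⟨0, by simp, by simp⟩
  | succ k ih =>
    obtain ⟨g, hg, hgk⟩ := ih
    obtain ⟨g', hg', hle⟩ := exists_mem_signedRows_dotProduct_le B ha (g - (k : ℝ) • y)
    refine ⟨g + g', by rw [succ_nsmul]; exact Finset.add_mem_add hg hg', ?_⟩
    have hsplit : g + g' - ((k + 1 : ℕ) : ℝ) • y = (g - (k : ℝ) • y) + (g' - y) := by
      push_cast
      module
    rw [hsplit]
    generalize g - (k : ℝ) • y = u at hgk hle
    have hgg := dotProduct_self_le_of_mem_signedRows hτ hB hg'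
    have hgy := (abs_le.1 (show |g' ⬝ᵥ y| ≤ τ by linarith [two_mul_abs_dotProduct_le g' y])).1
    simp only [add_dotProduct, dotProduct_add, sub_dotProduct, dotProduct_sub]
    rw [dotProduct_comm g' u, dotProduct_comm y u, dotProduct_comm y g']
    push_cast
    rw [← hy] at hle
    linarith

/-- All combinations `r • g + s • h` of two sums `g`, `h` of `k` signed rows. -/
noncomputable def signedRowsNet (B : Matrix (Fin m) (Fin d) ℝ) (k : ℕ) (r s : ℝ) :
    Finset (Fin d → ℝ) :=
  ((k • signedRows B) ×ˢ (k • signedRows B)).image fun q => r • q.1 + s • q.2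

section WeightedOrthonormal

variable {B : Matrix (Fin m) (Fin d) ℝ} {w : Fin m → ℝ}

lemma sum_smul_row_dotProduct (B : Matrix (Fin m) (Fin d) ℝ) (w u : Fin m → ℝ)
    (z : Fin d → ℝ) : (∑ i, (w i * u i) • B i) ⬝ᵥ z = ∑ i, w i * (u i * (B *ᵥ z) i) := by
  rw [sum_dotProduct]
  refine Finset.sum_congr rfl fun i _ => ?_
  rw [smul_dotProduct, smul_eq_mul, mul_assoc]
  rfl

lemma sum_smul_row_eq_self (hB : Bᵀ * Matrix.diagonal w * B = 1) (x : Fin d → ℝ) :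
    ∑ i, (w i * (B *ᵥ x) i) • B i = x := by
  have h : (Bᵀ * Matrix.diagonal w * B) *ᵥ x = x := by rw [hB, one_mulVec]
  rw [← mulVec_mulVec, ← mulVec_mulVec] at h
  conv_rhs => rw [← h]
  ext j
  rw [Finset.sum_apply]
  refine Finset.sum_congr rfl fun i _ => ?_
  simp only [Pi.smul_apply, smul_eq_mul, transpose_apply, mulVec_diagonal]
  ring

lemma dotProduct_self_eq_sum (hB : Bᵀ * Matrix.diagonal w * B = 1) (x : Fin d → ℝ) :
    x ⬝ᵥ x = ∑ i, w i * (B *ᵥ x) i ^ 2 := by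
  conv_lhs => rw [← sum_smul_row_eq_self hB x]
  rw [sum_smul_row_dotProduct, sum_smul_row_eq_self hB]
  exact Finset.sum_congr rfl fun i _ => by ring

lemma sum_smul_row_dotProduct_self_le (hB : Bᵀ * Matrix.diagonal w * B = 1) (hw : ∀ i, 0 ≤ w i)
    (u : Fin m → ℝ) :
    (∑ i, (w i * u i) • B i) ⬝ᵥ (∑ i, (w i * u i) • B i) ≤ ∑ i, w i * u i ^ 2 := by
  set z := ∑ i, (w i * u i) • B i with hz
  have h₁ : z ⬝ᵥ z = ∑ i, w i * (u i * (B *ᵥ z) i) := by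
    conv_lhs => rw [hz]
    exact sum_smul_row_dotProduct B w u _
  have h₂ := dotProduct_self_eq_sum hB z
  have h₃ : 2 * ∑ i, w i * (u i * (B *ᵥ z) i) ≤
      ∑ i, w i * u i ^ 2 + ∑ i, w i * (B *ᵥ z) i ^ 2 := by
    rw [Finset.mul_sum, ← Finset.sum_add_distrib]
    refine Finset.sum_le_sum fun i _ => ?_
    nlinarith [mul_nonneg (hw i) (sq_nonneg (u i - (B *ᵥ z) i))]
  linarith

lemma sum_le_one_of_wNorm_le_one {p : ℝ} (hp : 0 < p) {v : Fin m → ℝ}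
    (hv : wNorm w p v ≤ 1) : ∑ i, w i * |v i| ^ p ≤ 1 := by
  by_contra! h
  exact absurd hv (not_le.2 (Real.one_lt_rpow h (by positivity)))

lemma sq_le_rpow_mul_rpow {a b p : ℝ} (ha : 0 ≤ a) (hab : a ≤ b) (hp₂ : p < 2) :
    a ^ 2 ≤ b ^ (2 - p) * a ^ p := by
  calc a ^ 2 = a ^ (2 - p) * a ^ p := by
        rw [← Real.rpow_add' ha (by norm_num)]
        norm_num
    _ ≤ b ^ (2 - p) * a ^ p := by
        gcongr

/-- The weighted `ℓ_p` ball has sup-radius at most `τ^{1/p}`. -/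
lemma abs_mulVec_le_of_le_rpow (hB : Bᵀ * Matrix.diagonal w * B = 1) (hw : ∀ i, 0 ≤ w i)
    {p τ t : ℝ} (hp : 0 < p) (hp₂ : p < 2) (ht : 0 ≤ t) (hτ : ∀ i, B i ⬝ᵥ B i ≤ τ)
    (hτt : τ ≤ t ^ p) {x : Fin d → ℝ} (hx : ∑ i, w i * |(B *ᵥ x) i| ^ p ≤ 1) (i : Fin m) :
    |(B *ᵥ x) i| ≤ t := by
  have : Nonempty (Fin m) := ⟨i⟩
  obtain ⟨k, hk⟩ := Finite.exists_max fun i => |(B *ᵥ x) i|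
  refine (hk i).trans ?_
  set M := |(B *ᵥ x) k| with hM
  rcases (abs_nonneg _ : 0 ≤ M).eq_or_lt with h0 | h0
  · exact h0.symm.le.trans ht
  have hxx : x ⬝ᵥ x ≤ M ^ (2 - p) := by
    rw [dotProduct_self_eq_sum hB]
    calc ∑ i, w i * (B *ᵥ x) i ^ 2 ≤ ∑ i, M ^ (2 - p) * (w i * |(B *ᵥ x) i| ^ p) := by
          refine Finset.sum_le_sum fun i _ => ?_
          rw [← sq_abs, mul_left_comm]
          exact mul_le_mul_of_nonneg_left (sq_le_rpow_mul_rpow (abs_nonneg _) (hk i) hp₂) (hw i)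
      _ = M ^ (2 - p) * ∑ i, w i * |(B *ᵥ x) i| ^ p := by rw [Finset.mul_sum]
      _ ≤ M ^ (2 - p) := mul_le_of_le_one_right (by positivity) hx
  have hcs : M ^ 2 ≤ (B k ⬝ᵥ B k) * (x ⬝ᵥ x) := by
    rw [hM, sq_abs]
    simpa only [dotProduct, mulVec, ← sq] using
      Finset.sum_mul_sq_le_sq_mul_sq Finset.univ (B k) x
  have hxx₀ : 0 ≤ x ⬝ᵥ x := Finset.sum_nonneg fun i _ => mul_self_nonneg _
  have hMp : M ^ (2 - p) * M ^ p ≤ M ^ (2 - p) * t ^ p := by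
    calc M ^ (2 - p) * M ^ p = M ^ 2 := by
          rw [← Real.rpow_add h0, sub_add_cancel, Real.rpow_two]
      _ ≤ (B k ⬝ᵥ B k) * (x ⬝ᵥ x) := hcs
      _ ≤ t ^ p * (x ⬝ᵥ x) := mul_le_mul_of_nonneg_right ((hτ k).trans hτt) hxx₀
      _ ≤ t ^ p * M ^ (2 - p) := mul_le_mul_of_nonneg_left hxx (by positivity)
      _ = M ^ (2 - p) * t ^ p := mul_comm _ _
  exact (Real.rpow_le_rpow_iff h0.le ht hp).1 (le_of_mul_le_mul_left hMp (by positivity))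

/-- Splitting at height `t`: a point of the weighted `ℓ_p` ball is a combination of the rows with
small coefficient sum plus a vector of small Euclidean norm. -/
lemma exists_coeff_of_sum_le_one (hB : Bᵀ * Matrix.diagonal w * B = 1) (hw : ∀ i, 0 ≤ w i)
    {p t : ℝ} (hp : 1 ≤ p) (hp₂ : p < 2) (ht : 0 < t) {x : Fin d → ℝ}
    (hx : ∑ i, w i * |(B *ᵥ x) i| ^ p ≤ 1) :
    ∃ a : Fin m → ℝ, ∑ i, |a i| ≤ 1 ∧
      (x - (t / t ^ p) • ∑ i, a i • B i) ⬝ᵥ (x - (t / t ^ p) • ∑ i, a i • B i) ≤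
        t ^ 2 / t ^ p := by
  set v := B *ᵥ x with hv
  have htp : 0 < t ^ p := by positivity
  refine ⟨fun i => if t < |v i| then t ^ p / t * (w i * v i) else 0, ?_, ?_⟩
  · refine (Finset.sum_le_sum fun i _ => ?_).trans hx
    dsimp only
    split_ifs with h
    · rw [abs_mul, abs_mul, abs_of_nonneg (hw i), abs_of_pos (div_pos htp ht), mul_left_comm]
      refine mul_le_mul_of_nonneg_left ?_ (hw i)
      have h0 : 0 < |v i| := ht.trans h
      calc t ^ p / t * |v i| = t ^ (p - 1) * |v i| := by rw [Real.rpow_sub_one ht.ne']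
        _ ≤ |v i| ^ (p - 1) * |v i| := by
            gcongr
        _ = |v i| ^ p := by rw [Real.rpow_sub_one h0.ne']; field_simp
    · rw [abs_zero]
      have := hw i
      positivity
  · have hsplit : x - (t / t ^ p) • ∑ i, (if t < |v i| then t ^ p / t * (w i * v i) else 0) • B i
        = ∑ i, (w i * if t < |v i| then 0 else v i) • B i := by
      conv_lhs => rw [← sum_smul_row_eq_self hB x, ← hv]
      rw [Finset.smul_sum, ← Finset.sum_sub_distrib]
      refine Finset.sum_congr rfl fun i _ => ?_
      split_ifs
      · rw [smul_smul, ← sub_smul]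
        congr 1
        field_simp
        ring
      · simp
    rw [hsplit]
    calc _ ≤ ∑ i, w i * (if t < |v i| then 0 else v i) ^ 2 :=
          sum_smul_row_dotProduct_self_le hB hw _
      _ ≤ ∑ i, t ^ (2 - p) * (w i * |v i| ^ p) := by
          refine Finset.sum_le_sum fun i _ => ?_
          rw [mul_left_comm]
          refine mul_le_mul_of_nonneg_left ?_ (hw i)
          split_ifs with h
          · rw [zero_pow two_ne_zero]
            positivity
          · rw [← sq_abs]
            exact sq_le_rpow_mul_rpow (abs_nonneg _) (not_lt.1 h) hp₂
      _ = t ^ (2 - p) * ∑ i, w i * |v i| ^ p := by rw [Finset.mul_sum]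
      _ ≤ t ^ (2 - p) := mul_le_of_le_one_right (by positivity) hx
      _ = t ^ 2 / t ^ p := by rw [Real.rpow_sub ht, Real.rpow_two]

/-- The explicit net: points of the weighted `ℓ_p` ball are approximated, up to `t` in the
row-wise sup norm, by two sums of `k ≥ 4τ/t^p` signed rows at two different scales. -/
lemma exists_mem_signedRowsNet_abs_mulVec_le (hB : Bᵀ * Matrix.diagonal w * B = 1) (hw : ∀ i, 0 ≤ w i)
    {p τ t : ℝ} (hp : 1 ≤ p) (hp₂ : p < 2) (ht : 0 < t) (hτ : 0 < τ)
    (hBτ : ∀ i, B i ⬝ᵥ B i ≤ τ) {k : ℕ} (hk : 4 * (τ / t ^ p) ≤ k) {x : Fin d → ℝ}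
    (hx : ∑ i, w i * |(B *ᵥ x) i| ^ p ≤ 1) :
    ∃ x' ∈ signedRowsNet B k (t / t ^ p / k) (t / τ), ∀ i, |(B *ᵥ (x - x')) i| ≤ t := by
  obtain ⟨a, ha, hz⟩ := exists_coeff_of_sum_le_one hB hw hp hp₂ ht hx
  obtain ⟨g, hg, hgk⟩ := exists_nsmul_signedRows_approx hτ.le hBτ ha k
  set y := ∑ i, a i • B i
  set P := t ^ p with hP
  have hP0 : 0 < P := by positivity
  have hk0 : (0 : ℝ) < k := lt_of_lt_of_le (by positivity) hk
  have hsplit : x - (t / P / k) • g = (x - (t / P) • y) - (t / P / k) • (g - (k : ℝ) • y) := by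
    have : t / P / k * k = t / P := by field_simp
    rw [smul_sub, smul_smul, this]
    abel
  have hu : ((t / P / k) • (g - (k : ℝ) • y)) ⬝ᵥ ((t / P / k) • (g - (k : ℝ) • y)) ≤
      t ^ 2 / P := by
    rw [smul_dotProduct, dotProduct_smul, smul_eq_mul, smul_eq_mul, ← mul_assoc]
    calc _ ≤ t / P / k * (t / P / k) * (4 * k * τ) := by gcongr
      _ = t ^ 2 / P * (4 * (τ / P) / k) := by field_simp
      _ ≤ t ^ 2 / P := mul_le_of_le_one_right (by positivity) ((div_le_one hk0).2 hk)
  have he : (x - (t / P / k) • g) ⬝ᵥ (x - (t / P / k) • g) ≤ k * (t ^ 2 / τ) := by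
    rw [hsplit]
    generalize (t / P / k) • (g - (k : ℝ) • y) = u at hu
    generalize x - (t / P) • y = z at hz
    have hzu := (abs_le.1 (show |z ⬝ᵥ u| ≤ t ^ 2 / P by
      linarith [two_mul_abs_dotProduct_le z u])).1
    have hk' : 4 * (t ^ 2 / P) ≤ k * (t ^ 2 / τ) := by
      calc 4 * (t ^ 2 / P) = 4 * (τ / P) * (t ^ 2 / τ) := by field_simp
        _ ≤ k * (t ^ 2 / τ) := by gcongr
    simp only [sub_dotProduct, dotProduct_sub]
    rw [dotProduct_comm u z]
    linarith
  obtain ⟨h, hh, hcov⟩ := exists_nsmul_signedRows_abs_mulVec_le hτ hBτ ht k _ he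
  exact ⟨_, Finset.mem_image_of_mem _ (Finset.mk_mem_product hg hh),
    fun i => by rw [← sub_sub]; exact hcov i⟩

end WeightedOrthonormal

lemma log_two_mul_add_one_le {m : ℕ} (hm : 2 ≤ m) :
    Real.log ((2 * m + 1 : ℕ) : ℝ) ≤ 3 * Real.log m := by
  have h : 2 * m + 1 ≤ m ^ 3 := by nlinarith [Nat.mul_le_mul hm hm]
  calc Real.log ((2 * m + 1 : ℕ) : ℝ) ≤ Real.log ((m ^ 3 : ℕ) : ℝ) :=
        Real.log_le_log (by positivity) (by exact_mod_cast h)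
    _ = 3 * Real.log m := by
        push_cast
        rw [Real.log_pow]
        norm_num

/-- The net of `exists_mem_signedRowsNet_abs_mulVec_le` has logarithmic size `O(k log m)`. -/
lemma log_card_signedRowsNet_le (hm : 2 ≤ m) (B : Matrix (Fin m) (Fin d) ℝ) (k : ℕ) (r s : ℝ) :
    Real.log (signedRowsNet B k r s).card ≤ 6 * k * Real.log m := by
  have hne : (signedRowsNet B k r s).Nonempty :=
    ⟨_, Finset.mem_image_of_mem _
      (Finset.mk_mem_product (zero_mem_nsmul_signedRows B k) (zero_mem_nsmul_signedRows B k))⟩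
  have hk : (k • signedRows B).card ≤ (2 * m + 1) ^ k :=
    Finset.card_nsmul_le.trans (Nat.pow_le_pow_left (card_signedRows_le B) k)
  have hcard : (signedRowsNet B k r s).card ≤ (2 * m + 1) ^ (2 * k) := by
    refine Finset.card_image_le.trans ?_
    rw [Finset.card_product, two_mul k, pow_add]
    exact Nat.mul_le_mul hk hk
  calc Real.log (signedRowsNet B k r s).card ≤ Real.log (((2 * m + 1) ^ (2 * k) : ℕ) : ℝ) :=
        Real.log_le_log (by exact_mod_cast hne.card_pos) (by exact_mod_cast hcard)
    _ = 2 * k * Real.log ((2 * m + 1 : ℕ) : ℝ) := by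
        rw [Nat.cast_pow, Real.log_pow]
        push_cast
        ring
    _ ≤ 2 * k * (3 * Real.log m) := by
        gcongr
        exact log_two_mul_add_one_le hm
    _ = 6 * k * Real.log m := by ring

end Covering

/-- Covering the weighted `ℓ_p` ball (`1 ≤ p < 2`) of a weighted-orthonormal matrix by
`ℓ_∞` balls of radius `t ≥ d^{-c}`, with `log`-covering number at most
`C·(1/t^p)·((log d)/(2−p) + log m)·τ`. -/
theorem stmt14 :
    ∀ c : ℝ, 1 ≤ c →
      ∃ C : ℝ, 0 < C ∧
        ∀ (p : ℝ), 1 ≤ p → p < 2 →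
        ∀ (m d : ℕ), 2 ≤ m → 2 ≤ d →
        ∀ (w : Fin m → ℝ), (∀ i, 1 ≤ w i) →
        ∀ (B : Matrix (Fin m) (Fin d) ℝ), Bᵀ * Matrix.diagonal w * B = 1 →
        ∀ (τ : ℝ), (∀ i, w i * (∑ j, (B i j) ^ 2) ≤ τ) →
        ∀ t : ℝ, (d : ℝ) ^ (-c) ≤ t →
          ∃ N : Finset (Fin d → ℝ),
            Real.log N.card ≤
              C * (1 / t ^ p) * (Real.log d / (2 - p) + Real.log m) * τ ∧
            ∀ x : Fin d → ℝ, wNorm w p (B.mulVec x) ≤ 1 →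
              ∃ x' ∈ N, ∀ i, |B.mulVec (x - x') i| ≤ t := by
  intro c _
  refine ⟨30, by norm_num, ?_⟩
  intro p hp hp₂ m d hm hd w hw B hB τ hτ t ht
  have hw0 : ∀ i, 0 ≤ w i := fun i => zero_le_one.trans (hw i)
  have hd0 : (0 : ℝ) < d := by exact_mod_cast (by omega : 0 < d)
  have ht0 : 0 < t := (Real.rpow_pos_of_pos hd0 _).trans_le ht
  have htp : 0 < t ^ p := by positivity
  have hBτ : ∀ i, B i ⬝ᵥ B i ≤ τ := fun i => by
    have h0 : 0 ≤ ∑ j, B i j ^ 2 := Finset.sum_nonneg fun j _ => sq_nonneg _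
    calc B i ⬝ᵥ B i = ∑ j, B i j ^ 2 := Finset.sum_congr rfl fun j _ => (sq _).symm
      _ ≤ w i * ∑ j, B i j ^ 2 := le_mul_of_one_le_left h0 (hw i)
      _ ≤ τ := hτ i
  have hτ0 : 0 ≤ τ :=
    (Finset.sum_nonneg fun j _ => mul_self_nonneg _).trans (hBτ ⟨0, by omega⟩)
  have hlogm : 0 ≤ Real.log m := Real.log_natCast_nonneg m
  have hlogd : 0 ≤ Real.log d / (2 - p) :=
    div_nonneg (Real.log_natCast_nonneg d) (by linarith)
  rcases le_or_gt τ (t ^ p) with hcase | hcase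
  · refine ⟨{0}, ?_, fun x hx => ⟨0, by simp, fun i => ?_⟩⟩
    · rw [Finset.card_singleton, Nat.cast_one, Real.log_one]
      positivity
    · rw [sub_zero]
      exact abs_mulVec_le_of_le_rpow hB hw0 (by linarith) hp₂ ht0.le hBτ hcase
        (sum_le_one_of_wNorm_le_one (by linarith) hx) i
  · have hτpos : 0 < τ := htp.trans hcase
    have hratio : 1 < τ / t ^ p := (one_lt_div htp).2 hcase
    set k := ⌈4 * (τ / t ^ p)⌉₊ with hk
    have hk5 : (k : ℝ) ≤ 5 * (τ / t ^ p) := by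
      linarith [Nat.ceil_lt_add_one (show 0 ≤ 4 * (τ / t ^ p) by positivity)]
    refine ⟨signedRowsNet B k (t / t ^ p / k) (t / τ), ?_, fun x hx => ?_⟩
    · calc _ ≤ 6 * k * Real.log m := log_card_signedRowsNet_le hm B k _ _
        _ ≤ 6 * (5 * (τ / t ^ p)) * Real.log m := by gcongr
        _ = 30 * (1 / t ^ p) * Real.log m * τ := by ring
        _ ≤ 30 * (1 / t ^ p) * (Real.log d / (2 - p) + Real.log m) * τ := by
            gcongr
            linarith
    · exact exists_mem_signedRowsNet_abs_mulVec_le hB hw0 hp hp₂ ht0 hτpos hBτ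
        (Nat.le_ceil _) (sum_le_one_of_wNorm_le_one (by linarith) hx)
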